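/- Deciding membership in TKR∀ (the class of knowledge bases all of whose restricted chase sequences are finite) is in Π¹₁. -/

import Mathlib

/-!
Common formalization framework for "Restricted Chase Termination: You Want More than Fairness"
(Carral, Gerlach, Larroque, Thomazo).

Syntax is encoded over natural numbers so that all finite objects (rules, databases, knowledge
bases, Turing machines) live in `Primcodable` types, which allows us to speak about
many-one reductions and about the arithmetical/analytical hierarchy.
-/

namespace ChaseTermination

/-! ### Terms, atoms, facts, rules, knowledge bases -/

/-- Ground terms: `Sum.inl c` is the constant `c`, `Sum.inr n` is the null `n`. -/
abbrev GroundTerm : Type := ℕ ⊕ ℕ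

/-- Terms of rules: `Sum.inl v` is the variable `v`, `Sum.inr g` a ground term. -/
abbrev RTerm : Type := ℕ ⊕ GroundTerm

/-- A fact: a predicate (coded by a natural number) applied to ground terms. -/
abbrev Fact : Type := ℕ × List GroundTerm

/-- An atom: a predicate applied to terms. -/
abbrev Atom : Type := ℕ × List RTerm

/-- An existential rule, given by its body and its head (lists of atoms);
the universally quantified variables are those occurring in the body, the existentially
quantified ones are the head variables not occurring in the body. -/
abbrev Rule : Type := List Atom × List Atom

abbrev RuleSet : Type := List Rule

abbrev Database : Type := List Fact

/-- A knowledge base: a (finite) rule set together with a database. -/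
abbrev KB : Type := RuleSet × Database

def atomHasVar (a : Atom) (v : ℕ) : Prop := (Sum.inl v : RTerm) ∈ a.2

def atomNullFree (a : Atom) : Prop := ∀ t ∈ a.2, ∀ n : ℕ, t ≠ Sum.inr (Sum.inr n)

def factNullFree (f : Fact) : Prop := ∀ t ∈ f.2, ∀ n : ℕ, t ≠ Sum.inr n

/-- A database is a finite fact set without nulls. -/
def IsDatabase (D : Database) : Prop := ∀ f ∈ D, factNullFree f

/-- Well-formed rule: non-empty head, no nulls. -/
def IsRule (r : Rule) : Prop := r.2 ≠ [] ∧ ∀ a ∈ r.1 ++ r.2, atomNullFree a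

def IsRuleSet (S : RuleSet) : Prop := ∀ r ∈ S, IsRule r

def IsKB (kb : KB) : Prop := IsRuleSet kb.1 ∧ IsDatabase kb.2

/-- `v` occurs in the body of `r` (i.e. is universally quantified). -/
def bodyVar (r : Rule) (v : ℕ) : Prop := ∃ a ∈ r.1, atomHasVar a v

/-- `v` is an existential variable of `r`. -/
def existVar (r : Rule) (v : ℕ) : Prop := (∃ a ∈ r.2, atomHasVar a v) ∧ ¬ bodyVar r v

def applyT (σ : ℕ → GroundTerm) : RTerm → GroundTerm
  | Sum.inl v => σ v
  | Sum.inr g => g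

def applyA (σ : ℕ → GroundTerm) (a : Atom) : Fact := (a.1, a.2.map (applyT σ))

/-- A trigger: a rule together with a substitution for its (universal) variables. -/
abbrev Trigger : Type := Rule × (ℕ → GroundTerm)

/-- The support of a trigger: the instantiated body. -/
def support (t : Trigger) : Set Fact := {f | ∃ a ∈ t.1.1, f = applyA t.2 a}

/-- A trigger is loaded for `F` if `F` includes its support. -/
def loaded (t : Trigger) (F : Set Fact) : Prop := ∀ a ∈ t.1.1, applyA t.2 a ∈ F

/-- `σ'` agrees with the substitution of `t` on all universally quantified (body) variables. -/
def agreesOnBody (t : Trigger) (σ' : ℕ → GroundTerm) : Prop :=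
  ∀ v, bodyVar t.1 v → σ' v = t.2 v

/-- A trigger is obsolete for `F` if some extension of its substitution to the existential
variables sends the head into `F`. -/
def obsolete (t : Trigger) (F : Set Fact) : Prop :=
  ∃ σ' : ℕ → GroundTerm, agreesOnBody t σ' ∧ ∀ a ∈ t.1.2, applyA σ' a ∈ F

/-- The (ground) terms occurring in a fact set. -/
def termsOf (F : Set Fact) : Set GroundTerm := {g | ∃ f ∈ F, g ∈ f.2}

/-- `σ'` is a proper output extension of the trigger `t` w.r.t. `F`: it agrees with the trigger
substitution on body variables and maps existential variables to pairwise distinct fresh nulls. -/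
def properExt (t : Trigger) (F : Set Fact) (σ' : ℕ → GroundTerm) : Prop :=
  agreesOnBody t σ' ∧
  (∀ v, existVar t.1 v → ∃ n : ℕ, σ' v = Sum.inr n ∧ (Sum.inr n : GroundTerm) ∉ termsOf F) ∧
  (∀ v w, existVar t.1 v → existVar t.1 w → σ' v = σ' w → v = w)

/-- The output of a trigger under an extended substitution. -/
def outputOf (t : Trigger) (σ' : ℕ → GroundTerm) : Set Fact := {f | ∃ a ∈ t.1.2, f = applyA σ' a}

/-- An active trigger of `S` for `F`: loaded and not obsolete. -/
def Active (S : RuleSet) (F : Set Fact) (t : Trigger) : Prop :=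
  t.1 ∈ S ∧ loaded t F ∧ ¬ obsolete t F

/-- One restricted chase step. -/
def ChaseStep (S : RuleSet) (F F' : Set Fact) : Prop :=
  ∃ t : Trigger, Active S F t ∧ ∃ σ', properExt t F σ' ∧ F' = F ∪ outputOf t σ'

def dbSet (D : Database) : Set Fact := {f | f ∈ D}

/-- A (possibly infinite) restricted chase derivation for `⟨S, D⟩`, of length `len ∈ ℕ∞`.
Beyond the length the fact sets stall, so that the result is always `⋃ i, fact i`. -/
structure Chase (S : RuleSet) (D : Set Fact) where
  len : ℕ∞
  fact : ℕ → Set Fact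
  trig : ℕ → Trigger
  ext : ℕ → ℕ → GroundTerm
  init : fact 0 = D
  activeAt : ∀ i : ℕ, (i : ℕ∞) < len → Active S (fact i) (trig i)
  extOk : ∀ i : ℕ, (i : ℕ∞) < len → properExt (trig i) (fact i) (ext i)
  succ : ∀ i : ℕ, (i : ℕ∞) < len → fact (i + 1) = fact i ∪ outputOf (trig i) (ext i)
  stall : ∀ i : ℕ, ¬ ((i : ℕ∞) < len) → fact (i + 1) = fact i

/-- Fairness: every trigger that becomes loaded is eventually obsolete.
A fair chase derivation is a *restricted chase sequence*; note that for a finite derivation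
fairness forces maximality (no active trigger remains at the end). -/
def Fair {S : RuleSet} {D : Set Fact} (c : Chase S D) : Prop :=
  ∀ t : Trigger, t.1 ∈ S → ∀ i : ℕ, loaded t (c.fact i) → ∃ j : ℕ, i ≤ j ∧ obsolete t (c.fact j)

/-- The result of a chase derivation. -/
def chaseResult {S : RuleSet} {D : Set Fact} (c : Chase S D) : Set Fact := ⋃ i, c.fact i

/-- The derivation is infinite (non-terminating). -/
def IsInfinite {S : RuleSet} {D : Set Fact} (c : Chase S D) : Prop := c.len = ⊤

/-- `TKR∀`: knowledge bases all of whose restricted chase sequences are finite. -/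
def TKRall (kb : KB) : Prop :=
  IsKB kb ∧ ¬ ∃ c : Chase kb.1 (dbSet kb.2), IsInfinite c ∧ Fair c

/-- `TRR∀`: rule sets universally terminating for the restricted chase on every database. -/
def TRRall (S : RuleSet) : Prop :=
  IsRuleSet S ∧ ∀ D : Database, IsDatabase D → ¬ ∃ c : Chase S (dbSet D), IsInfinite c ∧ Fair c

/-! ### Breadth-first chase -/

/-- The instance of a trigger: its rule together with its instantiated body (this determines the
substitution on all body variables). -/
def instOf (t : Trigger) : Rule × List Fact := (t.1, t.1.1.map (applyA t.2))

/-- The set of instances of active triggers (this is what "the number of triggers that are loaded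
and not obsolete" counts). -/
def activeInsts (S : RuleSet) (F : Set Fact) : Set (Rule × List Fact) :=
  {p | ∃ t : Trigger, Active S F t ∧ p = instOf t}

/-- The breadth-first condition (†): a trigger loaded at step `i` becomes obsolete within the
next `n` steps, where `n` is the number of active triggers at step `i`. -/
def BreadthFirst {S : RuleSet} {D : Set Fact} (c : Chase S D) : Prop :=
  ∀ i : ℕ, ∀ t : Trigger, t.1 ∈ S → loaded t (c.fact i) →
    ∃ j : ℕ, i ≤ j ∧ j ≤ i + (activeInsts S (c.fact i)).ncard ∧ obsolete t (c.fact j)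

/-- `TKRBF∀`: knowledge bases all of whose breadth-first chase sequences are finite. -/
def TKRBFall (kb : KB) : Prop :=
  IsKB kb ∧ ¬ ∃ c : Chase kb.1 (dbSet kb.2), IsInfinite c ∧ BreadthFirst c

/-- `TRRBF∀`: rule sets whose breadth-first chase terminates on every database. -/
def TRRBFall (S : RuleSet) : Prop :=
  IsRuleSet S ∧ ∀ D : Database, IsDatabase D →
    ¬ ∃ c : Chase S (dbSet D), IsInfinite c ∧ BreadthFirst c

/-! ### Classes of the arithmetical and analytical hierarchies -/

/-- `Π⁰₂` predicates, via the Kleene normal form `∀ m ∃ k. R`. -/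
def Pi02 {α : Type} [Primcodable α] (p : α → Prop) : Prop :=
  ∃ R : α × ℕ → ℕ → Bool, Computable₂ R ∧ ∀ a, p a ↔ ∀ m : ℕ, ∃ k : ℕ, R (a, m) k = true

/-- `Π¹₁` predicates, via the Kleene normal form: `p a` iff for every function `f : ℕ → ℕ` some
finite initial segment of `f` witnesses a computable predicate. -/
def Pi11 {α : Type} [Primcodable α] (p : α → Prop) : Prop :=
  ∃ R : α → List ℕ → Bool, Computable₂ R ∧
    ∀ a, p a ↔ ∀ f : ℕ → ℕ, ∃ k : ℕ, R a ((List.range k).map f) = true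

/-- `Π¹₁`-hardness: every `Π¹₁` problem many-one reduces to `p`. -/
def Pi11Hard {α : Type} [Primcodable α] (p : α → Prop) : Prop :=
  ∀ q : ℕ → Prop, Pi11 q → q ≤₀ p

def Pi11Complete {α : Type} [Primcodable α] (p : α → Prop) : Prop := Pi11 p ∧ Pi11Hard p

/-! ### Non-deterministic Turing machines -/

/-- A non-deterministic Turing machine `(numStates, alphaSize, table)`.
States are `0, …, numStates - 1` with initial state `0`; tape symbols `0, …, alphaSize - 1`
form `Γ` (so `{0,1} ⊆ Γ` iff `2 ≤ alphaSize`), and the blank `B` is coded by `alphaSize`.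
An entry `((q, a), (q', b, d))` means `(q', b, d) ∈ δ(q, a)`, with `d = true` for a right move
and `d = false` for a left move. -/
abbrev NTM : Type := ℕ × ℕ × List ((ℕ × ℕ) × (ℕ × ℕ × Bool))

def NTM.numStates (M : NTM) : ℕ := M.1
def NTM.blank (M : NTM) : ℕ := M.2.1
def NTM.table (M : NTM) : List ((ℕ × ℕ) × (ℕ × ℕ × Bool)) := M.2.2

/-- Well-formedness: `Γ ⊇ {0,1}`, transitions use valid states and symbols, and the machine
never writes the blank. -/
def NTM.WF (M : NTM) : Prop :=
  1 ≤ NTM.numStates M ∧ 2 ≤ NTM.blank M ∧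
    ∀ e ∈ NTM.table M, e.1.1 < NTM.numStates M ∧ e.1.2 ≤ NTM.blank M ∧
      e.2.1 < NTM.numStates M ∧ e.2.2.1 < NTM.blank M

/-- A configuration `(tape, p, q)`: tape contents (a list of symbol codes whose last cell is
blank and in which no proper symbol occurs after a blank), 0-based head position `p`,
and current state `q`. -/
abbrev Config : Type := List ℕ × ℕ × ℕ

def WFConfig (M : NTM) (ρ : Config) : Prop :=
  ρ.2.1 < ρ.1.length ∧ ρ.1.getLast? = some (NTM.blank M) ∧
    (∀ i j : ℕ, i ≤ j → j < ρ.1.length → ρ.1.getD i 0 = NTM.blank M →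
      ρ.1.getD j 0 = NTM.blank M) ∧
    (∀ a ∈ ρ.1, a ≤ NTM.blank M) ∧ ρ.2.2 < NTM.numStates M

/-- The one-step relation `Next_M` between configurations; each step extends the represented
part of the tape by one blank cell. -/
def NTM.Next (M : NTM) (ρ ρ' : Config) : Prop :=
  ∃ q' b : ℕ, ∃ d : Bool,
    ((ρ.2.2, ρ.1.getD ρ.2.1 0), (q', b, d)) ∈ NTM.table M ∧
    (d = true ∨ 1 ≤ ρ.2.1) ∧
    ρ' = (ρ.1.set ρ.2.1 b ++ [NTM.blank M], if d then ρ.2.1 + 1 else ρ.2.1 - 1, q')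

/-- The starting configuration of `M` on a word. -/
def startConfig (M : NTM) (w : List ℕ) : Config := (w ++ [NTM.blank M], 0, 0)

/-- Words are over the input alphabet `{0, 1}`. -/
def IsWord (w : List ℕ) : Prop := ∀ a ∈ w, a < 2

/-- There is a run of `M` starting in `ρ` that visits the state `qr` infinitely often.
(Such a run is necessarily infinite, and every infinite sequence of `Next_M`-successive
configurations is a run; finite runs trivially feature `qr` only finitely many times.) -/
def RecurringFrom (M : NTM) (qr : ℕ) (ρ : Config) : Prop :=
  ∃ c : ℕ → Config, c 0 = ρ ∧ (∀ i, NTM.Next M (c i) (c (i + 1))) ∧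
    ∀ N : ℕ, ∃ i : ℕ, N ≤ i ∧ (c i).2.2 = qr

/-- `M` is non-recurring through `qr` on the configuration `ρ`: every run of `M` on `ρ`
features `qr` only finitely many times. -/
def NonRecurringFrom (M : NTM) (qr : ℕ) (ρ : Config) : Prop := ¬ RecurringFrom M qr ρ

end ChaseTermination
namespace ChaseTermination

/-! ### The rule set `Σ_M` of Section 4 and the databases `D_ρ` -/

/-- Predicate codes. `pF`, `pR` are the ternary time/tape successor predicates. -/
def pF : ℕ := 0
def pR : ℕ := 1
def pCL : ℕ := 2
def pCR : ℕ := 3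
def pReal : ℕ := 4
def pBrake : ℕ := 5
def pNextBr : ℕ := 6
def pEnd : ℕ := 7
/-- The binary letter predicate for the tape symbol `a`. -/
def pLetter (a : ℕ) : ℕ := 8 + 2 * a
/-- The binary state predicate for the state `q`. -/
def pState (q : ℕ) : ℕ := 9 + 2 * q

/-- Variable codes used in the rules: `x, y, x', y', w, w'` are `0, …, 5`. -/
def tv (v : ℕ) : RTerm := Sum.inl v

def A1 (p : ℕ) (s : RTerm) : Atom := (p, [s])
def A2 (p : ℕ) (s t : RTerm) : Atom := (p, [s, t])
def A3 (p : ℕ) (s t u : RTerm) : Atom := (p, [s, t, u])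

/-- `brSet(x, w)` as atoms: `{F(x,w,w), R(x,w,w), Real(x), Brake(w)}`. -/
def brSetA (x w : RTerm) : List Atom := [A3 pF x w w, A3 pR x w w, A1 pReal x, A1 pBrake w]

/-- Tape alphabet including the blank: `Γ ∪ {B}`. -/
def letters (M : NTM) : List ℕ := List.range (NTM.blank M + 1)
def states (M : NTM) : List ℕ := List.range (NTM.numStates M)

/-- The rule `R_Brake`. -/
def ruleBrake (M : NTM) : Rule :=
  ([A1 pBrake (tv 4)],
    ((letters M).map fun a => A2 (pLetter a) (tv 4) (tv 4)) ++
    ((states M).map fun q => A2 (pState q) (tv 4) (tv 4)) ++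
    [A3 pF (tv 4) (tv 4) (tv 4), A3 pR (tv 4) (tv 4) (tv 4),
     A2 pCL (tv 4) (tv 4), A2 pCR (tv 4) (tv 4), A1 pReal (tv 4), A2 pNextBr (tv 4) (tv 4)])

/-- The rule `R_nextBr`. -/
def ruleNextBr : Rule :=
  (brSetA (tv 0) (tv 4) ++ [A2 pNextBr (tv 4) (tv 5)], brSetA (tv 0) (tv 5))

/-- Transition rule for `(q', b, →) ∈ δ(q, a)` and the letter `c`; if `q = qr` a fresh
brake `w'` is created together with a `nextBr`-atom, otherwise the brake `w` is reused. -/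
def mkTransRight (qr q a q' b c : ℕ) : Rule :=
  ([A2 (pState q) (tv 0) (tv 4), A2 (pLetter a) (tv 0) (tv 4), A3 pR (tv 0) (tv 1) (tv 4),
    A2 (pLetter c) (tv 1) (tv 4)] ++ brSetA (tv 0) (tv 4) ++ brSetA (tv 1) (tv 4),
   if q = qr then
     [A2 (pState q') (tv 3) (tv 5), A2 (pLetter c) (tv 3) (tv 5), A2 (pLetter b) (tv 2) (tv 5),
      A3 pR (tv 2) (tv 3) (tv 5), A3 pF (tv 0) (tv 2) (tv 5), A3 pF (tv 1) (tv 3) (tv 5),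
      A2 pCL (tv 2) (tv 5), A2 pCR (tv 3) (tv 5)] ++
      brSetA (tv 2) (tv 5) ++ brSetA (tv 3) (tv 5) ++ [A2 pNextBr (tv 4) (tv 5)]
   else
     [A2 (pState q') (tv 3) (tv 4), A2 (pLetter c) (tv 3) (tv 4), A2 (pLetter b) (tv 2) (tv 4),
      A3 pR (tv 2) (tv 3) (tv 4), A3 pF (tv 0) (tv 2) (tv 4), A3 pF (tv 1) (tv 3) (tv 4),
      A2 pCL (tv 2) (tv 4), A2 pCR (tv 3) (tv 4)] ++ brSetA (tv 2) (tv 4) ++ brSetA (tv 3) (tv 4))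

/-- Transition rule for `(q', b, ←) ∈ δ(q, a)` and the letter `c`. -/
def mkTransLeft (qr q a q' b c : ℕ) : Rule :=
  ([A2 (pState q) (tv 0) (tv 4), A2 (pLetter a) (tv 0) (tv 4), A3 pR (tv 1) (tv 0) (tv 4),
    A2 (pLetter c) (tv 1) (tv 4)] ++ brSetA (tv 0) (tv 4) ++ brSetA (tv 1) (tv 4),
   if q = qr then
     [A2 (pState q') (tv 3) (tv 5), A2 (pLetter c) (tv 3) (tv 5), A2 (pLetter b) (tv 2) (tv 5),
      A3 pR (tv 3) (tv 2) (tv 5), A3 pF (tv 0) (tv 2) (tv 5), A3 pF (tv 1) (tv 3) (tv 5),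
      A2 pCL (tv 3) (tv 5), A2 pCR (tv 2) (tv 5)] ++
      brSetA (tv 2) (tv 5) ++ brSetA (tv 3) (tv 5) ++ [A2 pNextBr (tv 4) (tv 5)]
   else
     [A2 (pState q') (tv 3) (tv 4), A2 (pLetter c) (tv 3) (tv 4), A2 (pLetter b) (tv 2) (tv 4),
      A3 pR (tv 3) (tv 2) (tv 4), A3 pF (tv 0) (tv 2) (tv 4), A3 pF (tv 1) (tv 3) (tv 4),
      A2 pCL (tv 3) (tv 4), A2 pCR (tv 2) (tv 4)] ++ brSetA (tv 2) (tv 4) ++ brSetA (tv 3) (tv 4))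

/-- All transition rules of `Σ_M` (one per table entry and letter `c`). -/
def transRules (M : NTM) (qr : ℕ) : List Rule :=
  (NTM.table M).foldr (fun e acc =>
    ((letters M).map fun cc =>
      if e.2.2.2 = true then mkTransRight qr e.1.1 e.1.2 e.2.1 e.2.2.1 cc
      else mkTransLeft qr e.1.1 e.1.2 e.2.1 e.2.2.1 cc) ++ acc) []

/-- The rule `R_{C_R}` for the letter `a`. -/
def mkCopyRight (a : ℕ) : Rule :=
  ([A2 pCR (tv 2) (tv 5), A3 pF (tv 0) (tv 2) (tv 5), A3 pR (tv 0) (tv 1) (tv 4),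
    A2 (pLetter a) (tv 1) (tv 4)] ++
    brSetA (tv 0) (tv 4) ++ brSetA (tv 2) (tv 5) ++ brSetA (tv 1) (tv 4),
   [A3 pF (tv 1) (tv 3) (tv 5), A3 pR (tv 2) (tv 3) (tv 5), A2 (pLetter a) (tv 3) (tv 5),
    A2 pCR (tv 3) (tv 5)] ++ brSetA (tv 3) (tv 5))

/-- The rule `R_{C_L}` for the letter `a`. -/
def mkCopyLeft (a : ℕ) : Rule :=
  ([A2 pCL (tv 2) (tv 5), A3 pF (tv 0) (tv 2) (tv 5), A3 pR (tv 1) (tv 0) (tv 4),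
    A2 (pLetter a) (tv 1) (tv 4)] ++
    brSetA (tv 0) (tv 4) ++ brSetA (tv 2) (tv 5) ++ brSetA (tv 1) (tv 4),
   [A3 pF (tv 1) (tv 3) (tv 5), A3 pR (tv 3) (tv 2) (tv 5), A2 (pLetter a) (tv 3) (tv 5),
    A2 pCL (tv 3) (tv 5)] ++ brSetA (tv 3) (tv 5))

def copyRightRules (M : NTM) : List Rule := (letters M).map mkCopyRight
def copyLeftRules (M : NTM) : List Rule := (letters M).map mkCopyLeft

/-- The tape-extension rule `R_End`. -/
def ruleEnd (M : NTM) : Rule :=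
  ([A2 pCR (tv 2) (tv 5), A3 pF (tv 0) (tv 2) (tv 5), A2 pEnd (tv 0) (tv 4)] ++
    brSetA (tv 0) (tv 4) ++ brSetA (tv 2) (tv 5),
   [A3 pR (tv 2) (tv 3) (tv 5), A2 (pLetter (NTM.blank M)) (tv 3) (tv 5),
    A2 pEnd (tv 3) (tv 5)] ++ brSetA (tv 3) (tv 5))

/-- The rule set `Σ_M` of Section 4 (simulating `M`, with the designated state `qr`). -/
def SigmaM (M : NTM) (qr : ℕ) : RuleSet :=
  [ruleBrake M, ruleNextBr] ++ transRules M qr ++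
    copyLeftRules M ++ copyRightRules M ++ [ruleEnd M]

/-- The constant `c_i` (0-based). -/
def cst (i : ℕ) : GroundTerm := Sum.inl (i + 1)
/-- The brake constant `w₁` of the database. -/
def w1 : GroundTerm := Sum.inl 0

/-- `brSet(x, w)` as facts. -/
def brSetF (x w : GroundTerm) : List Fact :=
  [(pF, [x, w, w]), (pR, [x, w, w]), (pReal, [x]), (pBrake, [w])]

/-- The database `D_ρ` encoding a configuration `ρ`. -/
def Drho (M : NTM) (ρ : Config) : Database :=
  ((List.range ρ.1.length).map fun i => ((pR, [cst i, cst (i + 1), w1]) : Fact)) ++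
  ((List.range ρ.1.length).map fun i => ((pLetter (ρ.1.getD i 0), [cst i, w1]) : Fact)) ++
  [((pState ρ.2.2, [cst ρ.2.1, w1]) : Fact),
   ((pLetter (NTM.blank M), [cst ρ.1.length, w1]) : Fact),
   ((pEnd, [cst ρ.1.length, w1]) : Fact)] ++
  (List.range (ρ.1.length + 1)).foldr (fun i acc => brSetF (cst i) w1 ++ acc) []

/-! ### Wild frontiers -/

/-- The atoms explicitly required by the wild-frontier condition ("other" atoms are those
not in this set). -/
def wfListed (M : NTM) (ρ : Config) (w : GroundTerm) (x : ℕ → GroundTerm) : Set Fact :=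
  {f | (∃ i < ρ.1.length,
          f = ((pR, [x i, x (i + 1), w]) : Fact) ∨
          f = ((pLetter (ρ.1.getD i 0), [x i, w]) : Fact)) ∨
    f = ((pState ρ.2.2, [x ρ.2.1, w]) : Fact) ∨
    f = ((pEnd, [x ρ.1.length, w]) : Fact) ∨
    f = ((pLetter (NTM.blank M), [x ρ.1.length, w]) : Fact) ∨
    (∃ i ≤ ρ.1.length, f ∈ brSetF (x i) w)}

/-- `F` has a wild frontier of the configuration `ρ` overseen by `w` (Definition 4.4). -/
def WildFrontier (M : NTM) (F : Set Fact) (ρ : Config) (w : GroundTerm) : Prop :=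
  ∃ x : ℕ → GroundTerm,
    ((pReal, [w]) : Fact) ∉ F ∧
    (∀ i < ρ.1.length, ((pR, [x i, x (i + 1), w]) : Fact) ∈ F ∧
      ((pLetter (ρ.1.getD i 0), [x i, w]) : Fact) ∈ F) ∧
    ((pState ρ.2.2, [x ρ.2.1, w]) : Fact) ∈ F ∧
    ((pEnd, [x ρ.1.length, w]) : Fact) ∈ F ∧
    ((pLetter (NTM.blank M), [x ρ.1.length, w]) : Fact) ∈ F ∧
    (∀ i ≤ ρ.1.length, ∀ f ∈ brSetF (x i) w, f ∈ F) ∧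
    (∀ f ∈ F, f ∉ wfListed M ρ w x →
      ∀ i ≤ ρ.1.length, f.2.head? = some (x i) → f.2[1]? = some w)

/-! ### State atoms, generation, bow ties -/

/-- `g` is a brake of `F`. -/
def isBrake (F : Set Fact) (g : GroundTerm) : Prop := ((pBrake, [g]) : Fact) ∈ F

/-- A state atom of `F`: an atom `q(x, w)` with `q` a state of `M` and `x` not a brake. -/
def StateAtom (M : NTM) (F : Set Fact) (f : Fact) : Prop :=
  ∃ q : ℕ, q < NTM.numStates M ∧ ∃ x wb : GroundTerm,
    f = ((pState q, [x, wb]) : Fact) ∧ f ∈ F ∧ ¬ isBrake F x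

/-- `A` precedes `A'` in the derivation `c`: some applied trigger has `A` in its support
and `A'` in its output. -/
def precedes {S : RuleSet} {D : Set Fact} (c : Chase S D) (A A' : Fact) : Prop :=
  ∃ i : ℕ, (i : ℕ∞) < c.len ∧ A ∈ support (c.trig i) ∧ A' ∈ outputOf (c.trig i) (c.ext i)

/-- The fact `f` is generated (newly produced) at step `i` of the derivation `c`. -/
def generatedAt {S : RuleSet} {D : Set Fact} (c : Chase S D) (i : ℕ) (f : Fact) : Prop :=
  (i : ℕ∞) < c.len ∧ f ∈ outputOf (c.trig i) (c.ext i) ∧ f ∉ c.fact i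

/-- The fact `f` is generated by (an application of) one of the rules in `Rs`. -/
def generatedBy {S : RuleSet} {D : Set Fact} (c : Chase S D) (Rs : List Rule) (f : Fact) : Prop :=
  ∃ i : ℕ, generatedAt c i f ∧ (c.trig i).1 ∈ Rs

/-- Semantically meaningful terms: all terms of `F` except the brakes. -/
def semterms (F : Set Fact) : Set GroundTerm := {g | g ∈ termsOf F ∧ ¬ isBrake F g}

/-- The edge relation `E_R`: `(x, y) ∈ E_R` iff `R(x, y, w) ∈ F` for some `w`. -/
def ER (F : Set Fact) (u v : GroundTerm) : Prop := ∃ w, ((pR, [u, v, w]) : Fact) ∈ F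

/-- The weakly connected component of `x` in the graph induced by `E` on the vertex set `V`. -/
def wcc {α : Type} (V : Set α) (E : α → α → Prop) (x : α) : Set α :=
  {z | z ∈ V ∧ Relation.ReflTransGen (fun u v => u ∈ V ∧ v ∈ V ∧ (E u v ∨ E v u)) x z}

/-- Directed tree rooted in `r` on the vertex set `V` with edge relation `E`. -/
def IsDirTree {α : Type} (V : Set α) (E : α → α → Prop) (r : α) : Prop :=
  r ∈ V ∧
  (∀ v ∈ V, Relation.ReflTransGen (fun u v' => u ∈ V ∧ v' ∈ V ∧ E u v') r v) ∧
  (∀ v ∈ V, v ≠ r → ∃! u, u ∈ V ∧ E u v) ∧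
  (∀ u ∈ V, ¬ E u r)

/-- A bow tie with center `(x, y)` (Definition 6.2): `V_x^{-y}` induces a directed tree on the
inverse edges rooted in `x`, `V_y^{-x}` induces a directed tree rooted in `y`, and the two
components partition `V`. -/
def IsBowTie {α : Type} (V : Set α) (E : α → α → Prop) (x y : α) : Prop :=
  x ∈ V ∧ y ∈ V ∧ E x y ∧
  IsDirTree (wcc (V \ {y}) E x) (fun u v => E v u) x ∧
  IsDirTree (wcc (V \ {x}) E y) E y ∧
  wcc (V \ {y}) E x ∩ wcc (V \ {x}) E y = ∅ ∧
  wcc (V \ {y}) E x ∪ wcc (V \ {x}) E y = V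

/-- `bowtie(A)` for a state atom `q(x, w)`: the weakly connected component of `x` in
`(semterms F, E_R)`. -/
def bowtieOf (F : Set Fact) (x : GroundTerm) : Set GroundTerm := wcc (semterms F) (ER F) x

/-- A maximal `E`-path in the vertex set `V`. -/
def IsMaxPath {α : Type} (V : Set α) (E : α → α → Prop) (l : List α) : Prop :=
  l ≠ [] ∧ (∀ z ∈ l, z ∈ V) ∧ List.Chain' E l ∧
  (∀ z ∈ V, ∀ a, l.head? = some a → ¬ E z a) ∧
  (∀ z ∈ V, ∀ a, l.getLast? = some a → ¬ E a z)

/-- `configs(A)` (Definition 6.4): one candidate configuration per maximal path of `bowtie(A)`. -/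
def configsOf (M : NTM) (F : Set Fact) (A : Fact) : Set (Set Fact) :=
  {S | ∃ q : ℕ, ∃ x w : GroundTerm, A = ((pState q, [x, w]) : Fact) ∧
    ∃ l : List GroundTerm, IsMaxPath (bowtieOf F x) (ER F) l ∧
      S = insert A
        ({f | ∃ z ∈ l, f ∈ brSetF z w} ∪
         {f | f ∈ F ∧ (f.1 = pR ∨ f.1 = pEnd ∨ ∃ a ∈ letters M, f.1 = pLetter a) ∧
           f.2 ≠ [] ∧ f.2.getLast? = some w ∧ ∀ z ∈ f.2.dropLast, z ∈ l})}

/-- Homomorphic embedding of fact sets: a map on nulls (fixing all constants) sending `S`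
into `T`. -/
def mapG (h : ℕ → GroundTerm) : GroundTerm → GroundTerm
  | Sum.inl cc => Sum.inl cc
  | Sum.inr n => h n

def mapFact (h : ℕ → GroundTerm) (f : Fact) : Fact := (f.1, f.2.map (mapG h))

def HomEmbeds (S T : Set Fact) : Prop := ∃ h : ℕ → GroundTerm, ∀ f ∈ S, mapFact h f ∈ T

end ChaseTermination
namespace ChaseTermination

/-! ### The machine `M_Σ` (Definition 4.1), modelled by its canonical runs

A run of `M_Σ` on the encoding of a database corresponds exactly to a restricted chase
derivation of `⟨Σ, D⟩` (step 4 of the procedure) together with the counter `j`; the machine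
visits its designated state `q_r` once each time `j` is incremented (step 5), so a run visits
`q_r` infinitely often iff the derivation is infinite and `jseq` is unbounded. -/

open scoped Classical in
/-- The value of the counter `j` of `M_Σ` after `i` iterations of its main loop, when its
non-deterministic choices build the chase derivation `c`. -/
noncomputable def jseq {S : RuleSet} {D : Set Fact} (c : Chase S D) : ℕ → ℕ
  | 0 => 0
  | i + 1 =>
      if ∀ t : Trigger, Active S (c.fact (jseq c i)) t → obsolete t (c.fact i) then
        jseq c i + 1
      else jseq c i

/-! ### Oblivious and core chase variants -/

/-- A (possibly infinite) oblivious chase derivation: triggers need only be loaded, but no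
trigger (instance) is ever applied twice. -/
structure OblChase (S : RuleSet) (D : Set Fact) where
  len : ℕ∞
  fact : ℕ → Set Fact
  trig : ℕ → Trigger
  ext : ℕ → ℕ → GroundTerm
  init : fact 0 = D
  memAt : ∀ i : ℕ, (i : ℕ∞) < len → (trig i).1 ∈ S
  loadAt : ∀ i : ℕ, (i : ℕ∞) < len → loaded (trig i) (fact i)
  noRepeat : ∀ i j : ℕ, (i : ℕ∞) < len → (j : ℕ∞) < len →
    instOf (trig i) = instOf (trig j) → i = j
  extOk : ∀ i : ℕ, (i : ℕ∞) < len → properExt (trig i) (fact i) (ext i)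
  succ : ∀ i : ℕ, (i : ℕ∞) < len → fact (i + 1) = fact i ∪ outputOf (trig i) (ext i)
  stall : ∀ i : ℕ, ¬ ((i : ℕ∞) < len) → fact (i + 1) = fact i

/-- Fairness for the oblivious chase: every trigger that becomes loaded is eventually applied. -/
def OblFair {S : RuleSet} {D : Set Fact} (c : OblChase S D) : Prop :=
  ∀ t : Trigger, t.1 ∈ S → ∀ i : ℕ, loaded t (c.fact i) →
    ∃ j : ℕ, (j : ℕ∞) < c.len ∧ instOf (c.trig j) = instOf t

/-- `H` is a retract of `G`: `H ⊆ G` and some homomorphism (fixing constants) maps `G` into `H`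
leaving `H` pointwise fixed. -/
def RetractOf (G H : Set Fact) : Prop :=
  H ⊆ G ∧ ∃ h : ℕ → GroundTerm, (∀ f ∈ G, mapFact h f ∈ H) ∧ ∀ f ∈ H, mapFact h f = f

/-- `H` is a core of `G`: a retract of `G` without proper retracts. -/
def IsCoreOf (H G : Set Fact) : Prop := RetractOf G H ∧ ∀ H', RetractOf H H' → H' = H

/-- `G` is obtained from `F` by applying all active triggers in parallel, each with fresh
pairwise distinct nulls (distinct trigger instances use disjoint fresh nulls). -/
def IsParallelStep (S : RuleSet) (F G : Set Fact) : Prop :=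
  ∃ pe : Trigger → (ℕ → GroundTerm),
    (∀ t : Trigger, Active S F t → properExt t F (pe t)) ∧
    (∀ t t' : Trigger, Active S F t → Active S F t' → instOf t = instOf t' →
      outputOf t (pe t) = outputOf t' (pe t')) ∧
    (∀ t t' : Trigger, Active S F t → Active S F t' → instOf t ≠ instOf t' →
      ∀ n : ℕ, (Sum.inr n : GroundTerm) ∉ termsOf F →
        (Sum.inr n : GroundTerm) ∈ termsOf (outputOf t (pe t)) →
        (Sum.inr n : GroundTerm) ∉ termsOf (outputOf t' (pe t'))) ∧
    G = F ∪ ⋃ t ∈ {t : Trigger | Active S F t}, outputOf t (pe t)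

/-- A (possibly infinite) core chase sequence: `F_{i+1}` is a core of the parallel application
of all active triggers to `F_i`, and the sequence stops exactly when this is a fixpoint. -/
structure CoreChase (S : RuleSet) (D : Set Fact) where
  len : ℕ∞
  fact : ℕ → Set Fact
  init : fact 0 = D
  step : ∀ i : ℕ, (i : ℕ∞) < len →
    ∃ G, IsParallelStep S (fact i) G ∧ IsCoreOf (fact (i + 1)) G ∧ fact (i + 1) ≠ fact i
  halt : ∀ i : ℕ, ¬ ((i : ℕ∞) < len) → ∃ G, IsParallelStep S (fact i) G ∧ IsCoreOf (fact i) G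
  stall : ∀ i : ℕ, ¬ ((i : ℕ∞) < len) → fact (i + 1) = fact i

/-- The three chase variants. -/
inductive Variant : Type | obl | rest | core

/-- `qExists` ("sometimes") and `qForall` ("always") termination. -/
inductive Quant : Type | qExists | qForall

/-- `Terminates v q S D`: the knowledge base `⟨S, D⟩` `q`-terminates for the chase variant `v`
(`qExists`: some chase sequence is finite; `qForall`: all chase sequences are finite). -/
def Terminates (v : Variant) (q : Quant) (S : RuleSet) (D : Set Fact) : Prop :=
  match v, q with
  | .rest, .qExists => ∃ c : Chase S D, Fair c ∧ c.len ≠ ⊤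
  | .rest, .qForall => ∀ c : Chase S D, Fair c → c.len ≠ ⊤
  | .obl, .qExists => ∃ c : OblChase S D, OblFair c ∧ c.len ≠ ⊤
  | .obl, .qForall => ∀ c : OblChase S D, OblFair c → c.len ≠ ⊤
  | .core, .qExists => ∃ c : CoreChase S D, c.len ≠ ⊤
  | .core, .qForall => ∀ c : CoreChase S D, c.len ≠ ⊤

end ChaseTermination

namespace ChaseTermination

/-! ### Primitive recursive bounded quantification and membership -/

theorem primrecPred_forall_mem {α β : Type*} [Primcodable α] [Primcodable β] {f : α → List β}
    {p : α → β → Prop} (hf : Primrec f) (hp : PrimrecRel p) :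
    PrimrecPred fun a => ∀ b ∈ f a, p a b :=
  PrimrecRel.comp (PrimrecRel.forall_mem_list hp.swap) hf Primrec.id

theorem primrecPred_exists_mem {α β : Type*} [Primcodable α] [Primcodable β] {f : α → List β}
    {p : α → β → Prop} (hf : Primrec f) (hp : PrimrecRel p) :
    PrimrecPred fun a => ∃ b ∈ f a, p a b :=
  PrimrecRel.comp (PrimrecRel.exists_mem_list hp.swap) hf Primrec.id

theorem primrecRel_mem {α : Type*} [Primcodable α] :
    PrimrecRel fun (a : α) (l : List α) => a ∈ l := by
  have h : PrimrecRel fun (x : α × List α) (b : α) => x.1 = b :=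
    Primrec.eq.comp (Primrec.fst.comp Primrec.fst) Primrec.snd
  exact (primrecPred_exists_mem Primrec.snd h).of_eq fun x => by simp

theorem primrecPred_imp {α : Type*} [Primcodable α] {p q : α → Prop} (hp : PrimrecPred p)
    (hq : PrimrecPred q) : PrimrecPred fun a => p a → q a :=
  (hp.not.or hq).of_eq fun _ => imp_iff_not_or.symm

/-- The complement of a predicate stating the existence of a function all of whose local
configurations (three values at a time) satisfy a primitive recursive condition is `Π¹₁`. -/
theorem pi11_of_local_condition {α β γ : Type} [Primcodable α] [Primcodable β] [Primcodable γ]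
    [Inhabited γ] {p : α → Prop} {Q : α × (β × ℕ × ℕ × ℕ) × (γ × γ × γ) → Prop}
    (hQ : PrimrecPred Q)
    (h : ∀ a, p a ↔ ¬ ∃ f : ℕ → γ, ∀ b n i j, Q (a, (b, n, i, j), (f n, f i, f j))) :
    Pi11 p := by
  classical
  let val : List ℕ → ℕ → γ := fun l n => ((Encodable.decode (l.getD n 0) : Option γ)).getD default
  have hval : Primrec₂ val :=
    Primrec.option_getD_default.comp (Primrec.decode.comp (Primrec.list_getD 0))
  let V : α × List ℕ → Prop := fun x =>
    ∃ y ∈ (Encodable.decode₂ (β × ℕ × ℕ × ℕ) (x.2.length - 1)).toList,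
      x.2 ≠ [] ∧ ¬ Q (x.1, y, (val x.2 y.2.1, val x.2 y.2.2.1, val x.2 y.2.2.2))
  have hV : PrimrecPred V := by
    have hx : Primrec fun z : (α × List ℕ) × (β × ℕ × ℕ × ℕ) => z.1.2 :=
      Primrec.snd.comp Primrec.fst
    have hy : Primrec fun z : (α × List ℕ) × (β × ℕ × ℕ × ℕ) => z.2.2 :=
      Primrec.snd.comp Primrec.snd
    refine primrecPred_exists_mem
      (Primrec.optionToList.comp (Primrec.decode₂.comp
        (Primrec.nat_sub.comp (Primrec.list_length.comp Primrec.snd) (Primrec.const 1)))) ?_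
    refine (Primrec.eq.comp hx (Primrec.const [])).not.and (hQ.comp ?_).not
    exact (Primrec.fst.comp Primrec.fst).pair (Primrec.snd.pair
      ((hval.comp hx (Primrec.fst.comp hy)).pair
        ((hval.comp hx (Primrec.fst.comp (Primrec.snd.comp hy))).pair
          (hval.comp hx (Primrec.snd.comp (Primrec.snd.comp hy))))))
  have hle : ∀ b : β, ∀ n i j : ℕ, n ≤ Encodable.encode (b, n, i, j) ∧
      i ≤ Encodable.encode (b, n, i, j) ∧ j ≤ Encodable.encode (b, n, i, j) := by
    intro b n i j
    simp only [Encodable.encode_prod_val, Encodable.encode_nat]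
    have h1 := Nat.right_le_pair (Encodable.encode b) (Nat.pair n (Nat.pair i j))
    have h2 := Nat.left_le_pair n (Nat.pair i j)
    have h3 := Nat.right_le_pair n (Nat.pair i j)
    have h4 := Nat.left_le_pair i j
    have h5 := Nat.right_le_pair i j
    omega
  have hlook : ∀ (f : ℕ → ℕ) (k n : ℕ), n < k →
      val ((List.range k).map f) n = ((Encodable.decode (f n) : Option γ)).getD default := by
    intro f k n hn
    simp [val, List.getD_eq_getElem?_getD, hn]
  refine ⟨fun a l => decide (V (a, l)), hV.decide.to_comp, fun a => ?_⟩
  rw [h a]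
  constructor
  · intro hno f
    by_contra hall
    push Not at hall
    refine hno ⟨fun n => ((Encodable.decode (f n) : Option γ)).getD default, fun b n i j => ?_⟩
    by_contra hQ'
    obtain ⟨h1, h2, h3⟩ := hle b n i j
    refine hall (Encodable.encode (b, n, i, j) + 1) (decide_eq_true ⟨(b, n, i, j), ?_, ?_, ?_⟩)
    · exact Option.mem_toList.2 (Encodable.mem_decode₂.2 (by simp))
    · simp
    · simp only
      rw [hlook _ _ _ (by omega), hlook _ _ _ (by omega), hlook _ _ _ (by omega)]
      exact hQ'
  · rintro hR ⟨f, hf⟩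
    obtain ⟨k, hk⟩ := hR fun n => Encodable.encode (f n)
    obtain ⟨⟨b, n, i, j⟩, hy, hne, hnQ⟩ := of_decide_eq_true hk
    replace hy := Encodable.mem_decode₂.1 (Option.mem_toList.1 hy)
    simp only [List.length_map, List.length_range] at hy
    have hk0 : k ≠ 0 := by rintro rfl; simp at hne
    obtain ⟨h1, h2, h3⟩ := hle b n i j
    simp only at hnQ
    rw [hlook _ _ _ (by omega), hlook _ _ _ (by omega), hlook _ _ _ (by omega)] at hnQ
    simp only [Encodable.encodek, Option.getD_some] at hnQ
    exact hnQ (hf b n i j)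

/-! ### Finite substitutions -/

/-- The substitution listed by `τ`. -/
def listSubst (τ : List GroundTerm) (v : ℕ) : GroundTerm := τ.getD v (Sum.inl 0)

/-- The terms occurring in a list of atoms. -/
def termList (as : List Atom) : List RTerm := as.flatMap fun a => a.2

theorem primrec_applyT : Primrec₂ fun (τ : List GroundTerm) s => applyT (listSubst τ) s :=
  (Primrec.sumCasesOn Primrec.snd
    ((Primrec.list_getD (Sum.inl 0)).comp (Primrec.fst.comp Primrec.fst) Primrec.snd).to₂
    Primrec.snd.to₂).of_eq fun x => by
      obtain ⟨τ, s | s⟩ := x <;> rfl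

theorem primrec_applyA : Primrec₂ fun (τ : List GroundTerm) a => applyA (listSubst τ) a :=
  (Primrec.fst.comp Primrec.snd).pair
    (Primrec.list_map (Primrec.snd.comp Primrec.snd)
      (primrec_applyT.comp (Primrec.fst.comp Primrec.fst) Primrec.snd).to₂)

theorem primrec_termList : Primrec termList :=
  Primrec.list_flatMap Primrec.id (Primrec.snd.comp Primrec.snd).to₂

theorem primrec_isLeft {α β : Type*} [Primcodable α] [Primcodable β] :
    Primrec (Sum.isLeft : α ⊕ β → Bool) :=
  (Primrec.sumCasesOn Primrec.id (Primrec.const true).to₂ (Primrec.const false).to₂).of_eq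
    fun x => by cases x <;> rfl

theorem primrec_isRight {α β : Type*} [Primcodable α] [Primcodable β] :
    Primrec (Sum.isRight : α ⊕ β → Bool) :=
  (Primrec.sumCasesOn Primrec.id (Primrec.const false).to₂ (Primrec.const true).to₂).of_eq
    fun x => by cases x <;> rfl

theorem mem_termList_inl {as : List Atom} {v : ℕ} :
    Sum.inl v ∈ termList as ↔ ∃ a ∈ as, atomHasVar a v := by
  simp [termList, atomHasVar]

theorem applyA_congr {σ σ' : ℕ → GroundTerm} {a : Atom}
    (h : ∀ v, atomHasVar a v → σ v = σ' v) : applyA σ a = applyA σ' a := by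
  refine Prod.ext rfl (List.map_congr_left fun s hs => ?_)
  cases s with
  | inl v => exact h v hs
  | inr g => rfl

theorem exists_listSubst_eq (r : Rule) (σ : ℕ → GroundTerm) :
    ∃ τ : List GroundTerm, ∀ v, (∃ a ∈ r.1 ++ r.2, atomHasVar a v) → listSubst τ v = σ v := by
  obtain ⟨N, hN⟩ : ∃ N : ℕ, ∀ v, (Sum.inl v : RTerm) ∈ termList (r.1 ++ r.2) → v < N := by
    generalize termList (r.1 ++ r.2) = l
    induction l with
    | nil => exact ⟨0, by simp⟩
    | cons s l ih =>
      obtain ⟨N, hN⟩ := ih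
      cases s with
      | inl w =>
        refine ⟨max N (w + 1), fun v hv => ?_⟩
        rcases List.mem_cons.1 hv with hv | hv
        · cases hv; omega
        · have := hN v hv; omega
      | inr g =>
        exact ⟨N, fun v hv => hN v (by simpa using hv)⟩
  refine ⟨(List.range N).map σ, fun v hv => ?_⟩
  have := hN v (mem_termList_inl.2 hv)
  simp [listSubst, List.getD_eq_getElem?_getD, this]

/-! ### Decidability of the local conditions on chase derivations -/

theorem primrecPred_forall_mem_applyA :
    PrimrecPred fun x : List Atom × List GroundTerm × List Fact =>
      ∀ a ∈ x.1, applyA (listSubst x.2.1) a ∈ dbSet x.2.2 :=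
  primrecPred_forall_mem Primrec.fst
    (primrecRel_mem.comp
      (primrec_applyA.comp (Primrec.fst.comp (Primrec.snd.comp Primrec.fst)) Primrec.snd)
      (Primrec.snd.comp (Primrec.snd.comp Primrec.fst)))

theorem agreesOnBody_iff {r : Rule} {σ σ' : ℕ → GroundTerm} :
    agreesOnBody (r, σ) σ' ↔ ∀ s ∈ termList r.1, applyT σ' s = applyT σ s := by
  constructor
  · rintro h (v | g) hs
    · exact h v (mem_termList_inl.1 hs)
    · rfl
  · exact fun h v hv => h (Sum.inl v) (mem_termList_inl.2 hv)

theorem primrecPred_agreesOnBody :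
    PrimrecPred fun x : Rule × List GroundTerm × List GroundTerm =>
      agreesOnBody (x.1, listSubst x.2.1) (listSubst x.2.2) :=
  (primrecPred_forall_mem
    (p := fun x s => applyT (listSubst x.2.2) s = applyT (listSubst x.2.1) s)
    (primrec_termList.comp (Primrec.fst.comp Primrec.fst))
    (Primrec.eq.comp
      (primrec_applyT.comp (Primrec.snd.comp (Primrec.snd.comp Primrec.fst)) Primrec.snd)
      (primrec_applyT.comp (Primrec.fst.comp (Primrec.snd.comp Primrec.fst)) Primrec.snd))).of_eq
    fun _ => agreesOnBody_iff.symm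

/-- `s` is an existential variable of `r`, viewed as a term. -/
def IsExistTerm (r : Rule) (s : RTerm) : Prop := s.isLeft = true ∧ s ∉ termList r.1

theorem primrecRel_isExistTerm : PrimrecRel IsExistTerm :=
  (Primrec.eq.comp (primrec_isLeft.comp Primrec.snd) (Primrec.const true)).and
    (primrecRel_mem.comp Primrec.snd
      (primrec_termList.comp (Primrec.fst.comp Primrec.fst))).not

theorem existVar_iff {r : Rule} {v : ℕ} :
    existVar r v ↔ (Sum.inl v : RTerm) ∈ termList r.2 ∧ IsExistTerm r (Sum.inl v) := by
  rw [mem_termList_inl, IsExistTerm, mem_termList_inl]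
  simp [existVar, bodyVar]

theorem properExt_iff {r : Rule} {F : List Fact} {σ : ℕ → GroundTerm} :
    properExt (r, σ) (dbSet F) σ ↔ ∀ s ∈ termList r.2, IsExistTerm r s →
      (applyT σ s).isRight = true ∧ (∀ f ∈ F, applyT σ s ∉ f.2) ∧
      ∀ s' ∈ termList r.2, IsExistTerm r s' → applyT σ s = applyT σ s' → s = s' := by
  constructor
  · rintro ⟨-, hnew, hinj⟩ (v | g) hs hex
    · obtain ⟨n, hn, hfresh⟩ := hnew v (existVar_iff.2 ⟨hs, hex⟩)
      refine ⟨by simp [applyT, hn], fun f hf hmem => hfresh ⟨f, hf, ?_⟩, ?_⟩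
      · simpa only [applyT, hn] using hmem
      · rintro (w | g) hs' hex' heq
        · exact congrArg Sum.inl
            (hinj v w (existVar_iff.2 ⟨hs, hex⟩) (existVar_iff.2 ⟨hs', hex'⟩) heq)
        · simp [IsExistTerm] at hex'
    · simp [IsExistTerm] at hex
  · intro h
    refine ⟨fun v _ => rfl, fun v hv => ?_, fun v w hv hw heq => ?_⟩
    · obtain ⟨hr, hfresh, -⟩ := h _ (existVar_iff.1 hv).1 (existVar_iff.1 hv).2
      obtain ⟨n, hn⟩ := Sum.isRight_iff.1 hr
      refine ⟨n, hn, ?_⟩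
      rintro ⟨f, hf, hmem⟩
      exact hfresh f hf (hn ▸ hmem)
    · exact Sum.inl_injective ((h _ (existVar_iff.1 hv).1 (existVar_iff.1 hv).2).2.2 _
        (existVar_iff.1 hw).1 (existVar_iff.1 hw).2 heq)

theorem primrecPred_properExt :
    PrimrecPred fun x : Rule × List GroundTerm × List Fact =>
      properExt (x.1, listSubst x.2.1) (dbSet x.2.2) (listSubst x.2.1) := by
  refine PrimrecPred.of_eq ?_ fun _ => properExt_iff.symm
  have hhead : Primrec fun x : Rule × List GroundTerm × List Fact => termList x.1.2 :=
    primrec_termList.comp (Primrec.snd.comp Primrec.fst)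
  have himg : Primrec fun y : (Rule × List GroundTerm × List Fact) × RTerm =>
      applyT (listSubst y.1.2.1) y.2 :=
    primrec_applyT.comp (Primrec.fst.comp (Primrec.snd.comp Primrec.fst)) Primrec.snd
  refine primrecPred_forall_mem hhead (primrecPred_imp
    (primrecRel_isExistTerm.comp (Primrec.fst.comp Primrec.fst) Primrec.snd) ?_)
  refine (Primrec.eq.comp (primrec_isRight.comp himg) (Primrec.const true)).and
    (PrimrecPred.and ?_ ?_)
  · exact primrecPred_forall_mem (Primrec.snd.comp (Primrec.snd.comp Primrec.fst))
      (primrecRel_mem.comp (himg.comp Primrec.fst) (Primrec.snd.comp Primrec.snd)).not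
  · refine primrecPred_forall_mem (hhead.comp Primrec.fst) (primrecPred_imp
      (primrecRel_isExistTerm.comp (Primrec.fst.comp (Primrec.fst.comp Primrec.fst))
        Primrec.snd) ?_)
    exact primrecPred_imp
      (Primrec.eq.comp (himg.comp Primrec.fst)
        (himg.comp ((Primrec.fst.comp Primrec.fst).pair Primrec.snd)))
      (Primrec.eq.comp (Primrec.snd.comp Primrec.fst) Primrec.snd)

theorem primrecPred_atomNullFree : PrimrecPred atomNullFree := by
  have h : Primrec fun t : RTerm => (Sum.casesOn t (fun _ => true) fun g => g.isLeft : Bool) :=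
    Primrec.sumCasesOn Primrec.id (Primrec.const true).to₂ (primrec_isLeft.comp Primrec.snd).to₂
  refine (primrecPred_forall_mem
    (p := fun _ t => (Sum.casesOn t (fun _ => true) fun g => g.isLeft : Bool) = true) Primrec.snd
    (Primrec.eq.comp (h.comp Primrec.snd) (Primrec.const true))).of_eq fun a => ?_
  refine forall₂_congr fun t _ => ?_
  rcases t with v | c | n <;> simp

theorem primrecPred_factNullFree : PrimrecPred factNullFree := by
  refine (primrecPred_forall_mem (p := fun _ t => t.isLeft = true) Primrec.snd
    (Primrec.eq.comp (primrec_isLeft.comp Primrec.snd) (Primrec.const true))).of_eq fun f => ?_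
  refine forall₂_congr fun t _ => ?_
  rcases t with c | n <;> simp

theorem primrecPred_isKB : PrimrecPred IsKB := by
  have hrule : PrimrecPred IsRule :=
    (Primrec.eq.comp Primrec.snd (Primrec.const [])).not.and
      (primrecPred_atomNullFree.forall_mem_list.comp
        (Primrec.list_append.comp Primrec.fst Primrec.snd))
  exact (hrule.forall_mem_list.comp Primrec.fst).and
    (primrecPred_factNullFree.forall_mem_list.comp Primrec.snd)

/-- A stage of a coded derivation: the current facts, the rule applied next with the substitution
producing its output, and a pair consisting of a step and of a substitution, which witness that
the trigger coded by the index of the stage becomes obsolete. -/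
abbrev Stage : Type := (List Fact × Rule × List GroundTerm) × ℕ × List GroundTerm

/-- The `n`-th stage `x` and the `i`-th stage `y` are correct as initial or successive stages. -/
def StepCond (kb : KB) (n i : ℕ) (x y : Stage) : Prop :=
  (n = 0 → x.1.1 = kb.2) ∧
  (i = n + 1 → x.1.2.1 ∈ kb.1 ∧ loaded (x.1.2.1, listSubst x.1.2.2) (dbSet x.1.1) ∧
    properExt (x.1.2.1, listSubst x.1.2.2) (dbSet x.1.1) (listSubst x.1.2.2) ∧
    y.1.1 = x.1.1 ++ x.1.2.1.2.map (applyA (listSubst x.1.2.2)))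

/-- The substitution `τ` does not show that the trigger applied at the stage `x` is obsolete. -/
def NotObsoleteCond (x : Stage) (τ : List GroundTerm) : Prop :=
  ¬ (agreesOnBody (x.1.2.1, listSubst x.1.2.2) (listSubst τ) ∧
    ∀ a ∈ x.1.2.1.2, applyA (listSubst τ) a ∈ dbSet x.1.1)

/-- If `n` codes the trigger `b`, which is loaded at the stage `y`, then the witness at the
`n`-th stage `x` shows that it is obsolete at the `j`-th stage `z`. -/
def FairCond (kb : KB) (b : Rule × List GroundTerm) (n j : ℕ) (x y z : Stage) : Prop :=
  n = Encodable.encode b → j = x.2.1 → b.1 ∈ kb.1 → loaded (b.1, listSubst b.2) (dbSet y.1.1) →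
    agreesOnBody (b.1, listSubst b.2) (listSubst x.2.2) ∧
    ∀ a ∈ b.1.2, applyA (listSubst x.2.2) a ∈ dbSet z.1.1

theorem primrecPred_stepCond :
    PrimrecPred fun w : KB × (ℕ × ℕ) × Stage × Stage =>
      StepCond w.1 w.2.1.1 w.2.1.2 w.2.2.1 w.2.2.2 := by
  have hkb : Primrec fun w : KB × (ℕ × ℕ) × Stage × Stage => w.1 := Primrec.fst
  have hni : Primrec fun w : KB × (ℕ × ℕ) × Stage × Stage => w.2.1 :=
    Primrec.fst.comp Primrec.snd
  have hx : Primrec fun w : KB × (ℕ × ℕ) × Stage × Stage => w.2.2.1.1 :=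
    Primrec.fst.comp (Primrec.fst.comp (Primrec.snd.comp Primrec.snd))
  have hy : Primrec fun w : KB × (ℕ × ℕ) × Stage × Stage => w.2.2.2.1 :=
    Primrec.fst.comp (Primrec.snd.comp (Primrec.snd.comp Primrec.snd))
  have hF := Primrec.fst.comp hx
  have hr := Primrec.fst.comp (Primrec.snd.comp hx)
  have hτ := Primrec.snd.comp (Primrec.snd.comp hx)
  refine (primrecPred_imp (Primrec.eq.comp (Primrec.fst.comp hni) (Primrec.const 0))
    (Primrec.eq.comp hF (Primrec.snd.comp hkb))).and (primrecPred_imp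
    (Primrec.eq.comp (Primrec.snd.comp hni) (Primrec.succ.comp (Primrec.fst.comp hni)))
    (PrimrecPred.and ?_ (PrimrecPred.and ?_ (PrimrecPred.and ?_ ?_))))
  · exact primrecRel_mem.comp hr (Primrec.fst.comp hkb)
  · exact primrecPred_forall_mem_applyA.comp ((Primrec.fst.comp hr).pair (hτ.pair hF))
  · exact primrecPred_properExt.comp (hr.pair (hτ.pair hF))
  · exact Primrec.eq.comp (Primrec.fst.comp hy) (Primrec.list_append.comp hF
      (Primrec.list_map (Primrec.snd.comp hr)
        (primrec_applyA.comp (hτ.comp Primrec.fst) Primrec.snd).to₂))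

theorem primrecRel_notObsoleteCond : PrimrecRel NotObsoleteCond := by
  have hx : Primrec fun w : Stage × List GroundTerm => w.1.1 := Primrec.fst.comp Primrec.fst
  have hF := Primrec.fst.comp hx
  have hr := Primrec.fst.comp (Primrec.snd.comp hx)
  have hτ := Primrec.snd.comp (Primrec.snd.comp hx)
  exact ((primrecPred_agreesOnBody.comp (hr.pair (hτ.pair Primrec.snd))).and
    (primrecPred_forall_mem_applyA.comp
      ((Primrec.snd.comp hr).pair (Primrec.snd.pair hF)))).not

set_option synthInstance.maxSize 1024 in
set_option synthInstance.maxHeartbeats 200000 in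
theorem primrecPred_fairCond :
    PrimrecPred fun w : KB × ((Rule × List GroundTerm) × ℕ × ℕ) × Stage × Stage × Stage =>
      FairCond w.1 w.2.1.1 w.2.1.2.1 w.2.1.2.2 w.2.2.1 w.2.2.2.1 w.2.2.2.2 := by
  have hkb : Primrec fun w : KB × ((Rule × List GroundTerm) × ℕ × ℕ) × Stage × Stage × Stage =>
      w.1 := Primrec.fst
  have hv : Primrec fun w : KB × ((Rule × List GroundTerm) × ℕ × ℕ) × Stage × Stage × Stage =>
      w.2.1 := Primrec.fst.comp Primrec.snd
  have hb := Primrec.fst.comp hv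
  have hnj := Primrec.snd.comp hv
  have hs : Primrec fun w : KB × ((Rule × List GroundTerm) × ℕ × ℕ) × Stage × Stage × Stage =>
      w.2.2 := Primrec.snd.comp Primrec.snd
  have hx := Primrec.snd.comp (Primrec.fst.comp hs)
  have hy := Primrec.fst.comp (Primrec.fst.comp (Primrec.fst.comp (Primrec.snd.comp hs)))
  have hz := Primrec.fst.comp (Primrec.fst.comp (Primrec.snd.comp (Primrec.snd.comp hs)))
  have hr := Primrec.fst.comp hb
  have hτ := Primrec.snd.comp hb
  have hτ' := Primrec.snd.comp hx
  refine primrecPred_imp (Primrec.eq.comp (Primrec.fst.comp hnj) (Primrec.encode.comp hb))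
    (primrecPred_imp (Primrec.eq.comp (Primrec.snd.comp hnj) (Primrec.fst.comp hx))
    (primrecPred_imp (primrecRel_mem.comp hr (Primrec.fst.comp hkb))
    (primrecPred_imp ?_ (PrimrecPred.and ?_ ?_))))
  · exact primrecPred_forall_mem_applyA.comp ((Primrec.fst.comp hr).pair (hτ.pair hy))
  · exact primrecPred_agreesOnBody.comp (hr.pair (hτ.pair hτ'))
  · exact primrecPred_forall_mem_applyA.comp ((Primrec.snd.comp hr).pair (hτ'.pair hz))

/-! ### Coded derivations -/

theorem agreesOnBody.loaded_iff {r : Rule} {σ σ' : ℕ → GroundTerm} {F : Set Fact}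
    (h : agreesOnBody (r, σ) σ') : loaded (r, σ) F ↔ loaded (r, σ') F := by
  refine forall₂_congr fun a ha => ?_
  have : applyA σ' a = applyA σ a := applyA_congr fun v hv => h v ⟨a, ha, hv⟩
  simp only [this]

theorem obsolete.congr {r : Rule} {σ σ' : ℕ → GroundTerm} {F : Set Fact}
    (h : agreesOnBody (r, σ) σ') (ho : obsolete (r, σ') F) : obsolete (r, σ) F := by
  obtain ⟨ρ, hρ, hF⟩ := ho
  exact ⟨ρ, fun v hv => (hρ v hv).trans (h v hv), hF⟩

theorem obsolete.mono {t : Trigger} {F F' : Set Fact} (h : F ⊆ F') (ho : obsolete t F) :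
    obsolete t F' := by
  obtain ⟨ρ, hρ, hF⟩ := ho
  exact ⟨ρ, hρ, fun a ha => h (hF a ha)⟩

theorem dbSet_append (D E : Database) : dbSet (D ++ E) = dbSet D ∪ dbSet E := by
  ext f; simp [dbSet]

theorem dbSet_map_applyA (r : Rule) (σ σ' : ℕ → GroundTerm) :
    dbSet (r.2.map (applyA σ')) = outputOf (r, σ) σ' := by
  ext f; simp [dbSet, outputOf, eq_comm]

theorem Chase.fact_mono {S : RuleSet} {D : Set Fact} (c : Chase S D) : Monotone c.fact := by
  refine monotone_nat_of_le_succ fun i => ?_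
  by_cases hi : (i : ℕ∞) < c.len
  · rw [c.succ i hi]; exact Set.subset_union_left
  · rw [c.stall i hi]

/-- `f` codes an infinite fair chase derivation of `kb`. -/
def CodesFairChase (kb : KB) (f : ℕ → Stage) : Prop :=
  ∀ (b : Rule × List GroundTerm) (n i j : ℕ), StepCond kb n i (f n) (f i) ∧
    NotObsoleteCond (f n) b.2 ∧ FairCond kb b n j (f n) (f i) (f j)

theorem exists_chase_of_codes {kb : KB} {f : ℕ → Stage} (hf : CodesFairChase kb f) :
    ∃ c : Chase kb.1 (dbSet kb.2), IsInfinite c ∧ Fair c := by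
  have hstep := fun n => (hf (([], []), []) n (n + 1) 0).1.2 rfl
  let c : Chase kb.1 (dbSet kb.2) :=
    { len := ⊤
      fact := fun n => dbSet (f n).1.1
      trig := fun n => ((f n).1.2.1, listSubst (f n).1.2.2)
      ext := fun n => listSubst (f n).1.2.2
      init := congrArg dbSet ((hf (([], []), []) 0 0 0).1.1 rfl)
      activeAt := fun n _ => by
        refine ⟨(hstep n).1, (hstep n).2.1, ?_⟩
        rintro ⟨σ, hσ, hF⟩
        obtain ⟨τ, hτ⟩ := exists_listSubst_eq (f n).1.2.1 σ
        refine (hf ((f n).1.2.1, τ) n 0 0).2.1 ⟨fun v hv => ?_, fun a ha => ?_⟩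
        · obtain ⟨a, ha, hav⟩ := hv
          rw [hτ v ⟨a, List.mem_append_left _ ha, hav⟩]
          exact hσ v ⟨a, ha, hav⟩
        · rw [applyA_congr fun v hv => hτ v ⟨a, List.mem_append_right _ ha, hv⟩]
          exact hF a ha
      extOk := fun n _ => (hstep n).2.2.1
      succ := fun n _ => by
        rw [(hstep n).2.2.2, dbSet_append, dbSet_map_applyA]
      stall := fun n hn => absurd (ENat.natCast_lt_top n) hn }
  refine ⟨c, rfl, ?_⟩
  rintro ⟨r, σ⟩ hr i hl
  obtain ⟨τ, hτ⟩ := exists_listSubst_eq r σ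
  have hag : agreesOnBody (r, σ) (listSubst τ) := by
    rintro v ⟨a, ha, hav⟩
    exact hτ v ⟨a, List.mem_append_left _ ha, hav⟩
  have hob := (hf (r, τ) (Encodable.encode (r, τ)) i (f (Encodable.encode (r, τ))).2.1).2.2
    rfl rfl hr (hag.loaded_iff.1 hl)
  exact ⟨max i (f (Encodable.encode (r, τ))).2.1, le_max_left _ _,
    (obsolete.congr hag ⟨_, hob⟩).mono (c.fact_mono (le_max_right _ _))⟩

theorem exists_codes_of_chase {kb : KB} (c : Chase kb.1 (dbSet kb.2)) (hinf : IsInfinite c)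
    (hfair : Fair c) : ∃ f : ℕ → Stage, CodesFairChase kb f := by
  classical
  have hlt : ∀ n : ℕ, (n : ℕ∞) < c.len := fun n => by rw [hinf]; exact ENat.natCast_lt_top n
  choose τ hτ using fun n => exists_listSubst_eq (c.trig n).1 (c.ext n)
  have hbody : ∀ n v, bodyVar (c.trig n).1 v → listSubst (τ n) v = (c.trig n).2 v := by
    rintro n v ⟨a, ha, hav⟩
    rw [hτ n v ⟨a, List.mem_append_left _ ha, hav⟩]
    exact (c.extOk n (hlt n)).1 v ⟨a, ha, hav⟩
  have hag : ∀ n, agreesOnBody ((c.trig n).1, (c.trig n).2) (listSubst (τ n)) := hbody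
  have hhead : ∀ n, ∀ a ∈ (c.trig n).1.2, applyA (listSubst (τ n)) a = applyA (c.ext n) a :=
    fun n a ha => applyA_congr fun v hv => hτ n v ⟨a, List.mem_append_right _ ha, hv⟩
  let L : ℕ → List Fact := fun n => Nat.rec kb.2
    (fun n F => F ++ (c.trig n).1.2.map (applyA (listSubst (τ n)))) n
  have hL : ∀ n, dbSet (L n) = c.fact n := by
    intro n
    induction n with
    | zero => exact c.init.symm
    | succ n ih =>
      change dbSet (L n ++ _) = _
      rw [c.succ n (hlt n), dbSet_append, ih, List.map_congr_left (hhead n),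
        dbSet_map_applyA (c.trig n).1 (c.trig n).2]
  have hw : ∀ b : Rule × List GroundTerm, ∃ w : ℕ × List GroundTerm, ∀ i, b.1 ∈ kb.1 →
      loaded (b.1, listSubst b.2) (c.fact i) →
      agreesOnBody (b.1, listSubst b.2) (listSubst w.2) ∧
        ∀ a ∈ b.1.2, applyA (listSubst w.2) a ∈ c.fact w.1 := by
    intro b
    by_cases hb : ∃ i, b.1 ∈ kb.1 ∧ loaded (b.1, listSubst b.2) (c.fact i)
    · obtain ⟨i, hS, hl⟩ := hb
      obtain ⟨j, -, σ, hσ, hF⟩ := hfair _ hS i hl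
      obtain ⟨ρ, hρ⟩ := exists_listSubst_eq b.1 σ
      refine ⟨(j, ρ), fun _ _ _ => ⟨?_, fun a ha => ?_⟩⟩
      · rintro v ⟨a, ha, hav⟩
        rw [hρ v ⟨a, List.mem_append_left _ ha, hav⟩]
        exact hσ v ⟨a, ha, hav⟩
      · rw [applyA_congr fun v hv => hρ v ⟨a, List.mem_append_right _ ha, hv⟩]
        exact hF a ha
    · exact ⟨(0, []), fun i hS hl => absurd ⟨i, hS, hl⟩ hb⟩
  choose w hw using hw
  refine ⟨fun n => ((L n, (c.trig n).1, τ n),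
    ((Encodable.decode n : Option (Rule × List GroundTerm)).map w).getD (0, [])),
    fun b n i j => ⟨⟨?_, ?_⟩, ?_, ?_⟩⟩
  · rintro rfl; rfl
  · rintro rfl
    obtain ⟨hS, hl, -⟩ := c.activeAt n (hlt n)
    obtain ⟨-, hfresh, hinj⟩ := c.extOk n (hlt n)
    have hex : ∀ v, existVar (c.trig n).1 v → listSubst (τ n) v = c.ext n v := by
      rintro v ⟨⟨a, ha, hav⟩, -⟩
      exact hτ n v ⟨a, List.mem_append_right _ ha, hav⟩
    simp only [hL]
    refine ⟨hS, (hag n).loaded_iff.1 hl, ⟨fun _ _ => rfl, fun v hv => ?_, fun v u hv hu => ?_⟩,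
      rfl⟩
    · rw [hex v hv]; exact hfresh v hv
    · rw [hex v hv, hex u hu]; exact hinj v u hv hu
  · rintro ⟨h1, h2⟩
    simp only [hL] at h1 h2
    exact (c.activeAt n (hlt n)).2.2 (obsolete.congr (hag n) ⟨_, h1, h2⟩)
  · rintro rfl rfl hS hl
    simp only [hL, Encodable.encodek, Option.map_some, Option.getD_some] at hl ⊢
    exact hw b i hS hl

set_option synthInstance.maxSize 1024 in
set_option synthInstance.maxHeartbeats 200000 in
theorem primrecPred_local_condition :
    PrimrecPred fun w : KB × ((Rule × List GroundTerm) × ℕ × ℕ × ℕ) × (Stage × Stage × Stage) =>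
      IsKB w.1 → StepCond w.1 w.2.1.2.1 w.2.1.2.2.1 w.2.2.1 w.2.2.2.1 ∧
        NotObsoleteCond w.2.2.1 w.2.1.1.2 ∧
        FairCond w.1 w.2.1.1 w.2.1.2.1 w.2.1.2.2.2 w.2.2.1 w.2.2.2.1 w.2.2.2.2 := by
  have hkb : Primrec fun w : KB × ((Rule × List GroundTerm) × ℕ × ℕ × ℕ) ×
      (Stage × Stage × Stage) => w.1 := Primrec.fst
  have hv : Primrec fun w : KB × ((Rule × List GroundTerm) × ℕ × ℕ × ℕ) ×
      (Stage × Stage × Stage) => w.2.1 := Primrec.fst.comp Primrec.snd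
  have hs : Primrec fun w : KB × ((Rule × List GroundTerm) × ℕ × ℕ × ℕ) ×
      (Stage × Stage × Stage) => w.2.2 := Primrec.snd.comp Primrec.snd
  have hb := Primrec.fst.comp hv
  have hn := Primrec.fst.comp (Primrec.snd.comp hv)
  have hi := Primrec.fst.comp (Primrec.snd.comp (Primrec.snd.comp hv))
  have hj := Primrec.snd.comp (Primrec.snd.comp (Primrec.snd.comp hv))
  have hx := Primrec.fst.comp hs
  have hy := Primrec.fst.comp (Primrec.snd.comp hs)
  refine primrecPred_imp (primrecPred_isKB.comp hkb) (PrimrecPred.and ?_ (PrimrecPred.and ?_ ?_))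
  · exact primrecPred_stepCond.comp (hkb.pair ((hn.pair hi).pair (hx.pair hy)))
  · exact primrecRel_notObsoleteCond.comp hx (Primrec.snd.comp hb)
  · exact primrecPred_fairCond.comp (hkb.pair ((hb.pair (hn.pair hj)).pair hs))

/-- Deciding membership in `TKR∀` (the class of knowledge bases all of whose
restricted chase sequences are finite) is in `Π¹₁`. -/
theorem TKRall_in_Pi11 : Pi11 TKRall := by
  refine pi11_of_local_condition primrecPred_local_condition fun kb => ?_
  constructor
  · rintro ⟨hkb, hno⟩ ⟨f, hf⟩
    exact hno (exists_chase_of_codes (f := f) fun b n i j => hf b n i j hkb)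
  · intro hno
    have hkb : IsKB kb := by
      by_contra h
      exact hno ⟨default, fun _ _ _ _ hkb => absurd hkb h⟩
    refine ⟨hkb, ?_⟩
    rintro ⟨c, hinf, hfair⟩
    obtain ⟨f, hf⟩ := exists_codes_of_chase c hinf hfair
    exact hno ⟨f, fun b n i j _ => hf b n i j⟩

end ChaseTermination
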